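/- The blowup solution is mode stable: let λ ∈ ℂ with Re λ ≥ 0 and λ ≠ 1. If f : ℝ → ℂ is C^∞ on the interval [0,1] and satisfies, for all ρ ∈ (0,1), the equation −(1−ρ²)f''(ρ) − (2/ρ)f'(ρ) + 2(λ+1)ρ f'(ρ) + (2(1−6ρ²+ρ⁴)/(ρ²(1+ρ²)²)) f(ρ) + λ(λ+1) f(ρ) = 0, then f vanishes identically on [0,1]. -/

import Mathlib

open Set

/-- The spectral equation obtained by linearizing the corotational wave maps
equation in similarity coordinates around the self-similar blowup profile. -/
def SpectralEq (l : ℂ) (f : ℝ → ℂ) (ρ : ℝ) : Prop :=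
  -(1 - (ρ : ℂ)^2) * deriv (deriv f) ρ - (2 / (ρ : ℂ)) * deriv f ρ
    + 2 * (l + 1) * (ρ : ℂ) * deriv f ρ
    + (2 * (1 - 6 * (ρ : ℂ)^2 + (ρ : ℂ)^4) / ((ρ : ℂ)^2 * (1 + (ρ : ℂ)^2)^2)) * f ρ
    + l * (l + 1) * f ρ = 0

/-- The weight `ρ²(1+ρ²)/(2(3-ρ²))`, reciprocal to the potential of the supersymmetric partner of
the spectral problem. -/
noncomputable def partnerWeight (r : ℝ) : ℝ := r ^ 2 * (1 + r ^ 2) / (2 * (3 - r ^ 2))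

theorem partnerWeight_pos {r : ℝ} (hr : r ∈ Ioo (0 : ℝ) 1) : 0 < partnerWeight r := by
  have h0 := hr.1
  have h1 : 0 < 3 - r ^ 2 := by nlinarith [hr.1, hr.2]
  unfold partnerWeight
  positivity

theorem hasDerivAt_partnerWeight {r : ℝ} (hr : r ∈ Ioo (0 : ℝ) 1) :
    HasDerivAt partnerWeight (r * (3 + 6 * r ^ 2 - r ^ 4) / (3 - r ^ 2) ^ 2) r := by
  have h1 : 3 - r ^ 2 ≠ 0 := by nlinarith [hr.1, hr.2]
  have h := ((hasDerivAt_pow 2 r).mul ((hasDerivAt_pow 2 r).const_add 1)).div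
    (((hasDerivAt_pow 2 r).const_sub 3).const_mul 2) (mul_ne_zero two_ne_zero h1)
  refine h.congr_deriv ?_
  simp only [Pi.mul_apply]
  field_simp
  ring

theorem continuousOn_partnerWeight : ContinuousOn partnerWeight (Icc 0 1) := by
  unfold partnerWeight
  refine ContinuousOn.div (by fun_prop) (by fun_prop) fun r hr => ?_
  nlinarith [hr.1, hr.2]

theorem hasDerivAt_one_sub_sq_rpow {r : ℝ} (s : ℝ) (hr : r ∈ Ioo (0 : ℝ) 1) :
    HasDerivAt (fun x : ℝ => (1 - x ^ 2) ^ s) (-(2 * r * s * (1 - r ^ 2) ^ s / (1 - r ^ 2))) r := by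
  have h1 : 0 < 1 - r ^ 2 := by nlinarith [hr.1, hr.2]
  refine (((hasDerivAt_pow 2 r).const_sub 1).rpow_const (p := s) (Or.inl h1.ne')).congr_deriv ?_
  rw [Real.rpow_sub_one h1.ne']
  field_simp
  norm_num
  ring

/-- A function on `[0,1]` with nonnegative derivative in the interior that does not increase from
`0` to `1` is constant, so its derivative vanishes. -/
theorem deriv_eq_zero_of_nonneg_of_le {F F' : ℝ → ℝ} (hc : ContinuousOn F (Icc 0 1))
    (hd : ∀ r ∈ Ioo (0 : ℝ) 1, HasDerivAt F (F' r) r) (hn : ∀ r ∈ Ioo (0 : ℝ) 1, 0 ≤ F' r)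
    (hle : F 1 ≤ F 0) : ∀ r ∈ Ioo (0 : ℝ) 1, F' r = 0 := by
  have hmono : MonotoneOn F (Icc 0 1) := by
    refine monotoneOn_of_deriv_nonneg (convex_Icc 0 1) hc ?_ ?_
    · rw [interior_Icc]
      exact fun r hr => (hd r hr).differentiableAt.differentiableWithinAt
    · rw [interior_Icc]
      exact fun r hr => (hd r hr).deriv ▸ hn r hr
  intro r hr
  have hconst : F =ᶠ[nhds r] fun _ => F 0 := by
    filter_upwards [Ioo_mem_nhds hr.1 hr.2] with x hx
    have hx' := Ioo_subset_Icc_self hx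
    have h0 := hmono (left_mem_Icc.2 zero_le_one) hx' hx'.1
    have h1 := hmono hx' (right_mem_Icc.2 zero_le_one) hx'.2
    linarith
  exact (hd r hr).unique ((hasDerivAt_const r (F 0)).congr_of_eventuallyEq hconst)

theorem HasDerivAt.complex_re {g : ℝ → ℂ} {g' : ℂ} {r : ℝ} (h : HasDerivAt g g' r) :
    HasDerivAt (fun x => (g x).re) g'.re r :=
  Complex.reCLM.hasFDerivAt.comp_hasDerivAt r h

theorem HasDerivAt.complex_im {g : ℝ → ℂ} {g' : ℂ} {r : ℝ} (h : HasDerivAt g g' r) :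
    HasDerivAt (fun x => (g x).im) g'.im r :=
  Complex.imCLM.hasFDerivAt.comp_hasDerivAt r h

/-- The supersymmetric partner of the spectral problem, written as a first-order system, has no
nontrivial solution that is regular at both endpoints. -/
theorem partner_system_eq_zero {m : ℂ} (hm : m.re ≤ 1) {g P : ℝ → ℂ}
    (hgc : ContinuousOn g (Icc 0 1)) (hPc : ContinuousOn P (Icc 0 1))
    (hg : ∀ r ∈ Ioo (0 : ℝ) 1, HasDerivAt g (P r + ((1 + r)⁻¹ : ℝ) * (m * g r)) r)
    (hP : ∀ r ∈ Ioo (0 : ℝ) 1, HasDerivAt P (((1 - r ^ 2)⁻¹ : ℝ) *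
      (((partnerWeight r)⁻¹ : ℝ) * g r + (2 * r : ℝ) * P r - (1 + r : ℝ) * (m * P r))) r)
    (hg0 : g 0 = 0) (hg1 : g 1 = (m - 1) * P 1) : ∀ r ∈ Ioo (0 : ℝ) 1, g r = 0 := by
  have hwc : ContinuousOn (fun x : ℝ => (1 - x ^ 2) ^ (1 - m.re)) (Icc 0 1) :=
    ContinuousOn.rpow_const (by fun_prop) fun _ _ => Or.inr (by linarith)
  have hqc := continuousOn_partnerWeight
  have hgr : ContinuousOn (fun x => (g x).re) (Icc 0 1) := Complex.continuous_re.comp_continuousOn hgc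
  have hgi : ContinuousOn (fun x => (g x).im) (Icc 0 1) := Complex.continuous_im.comp_continuousOn hgc
  have hPr : ContinuousOn (fun x => (P x).re) (Icc 0 1) := Complex.continuous_re.comp_continuousOn hPc
  have hPi : ContinuousOn (fun x => (P x).im) (Icc 0 1) := Complex.continuous_im.comp_continuousOn hPc
  have hw1 : (0 : ℝ) ≤ (1 - 1 ^ 2) ^ (1 - m.re) := Real.rpow_nonneg (by norm_num) _
  by_cases hb : m.im = 0
  · have key := deriv_eq_zero_of_nonneg_of_le
      (F := fun x => (1 - x ^ 2) ^ (1 - m.re) * ((g x).re * (P x).re + (g x).im * (P x).im))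
      (F' := fun r => (1 - r ^ 2) ^ (1 - m.re) / (1 - r ^ 2) *
        ((partnerWeight r)⁻¹ * ((g r).re ^ 2 + (g r).im ^ 2) +
          (1 - r ^ 2) * ((P r).re ^ 2 + (P r).im ^ 2)))
      (by fun_prop) ?_ ?_ ?_
    · intro r hr
      have hq := partnerWeight_pos hr
      have h1 : 0 < 1 - r ^ 2 := by nlinarith [hr.1, hr.2]
      have hw : 0 < (1 - r ^ 2) ^ (1 - m.re) := Real.rpow_pos_of_pos h1 _
      have h := key r hr
      have hz : (partnerWeight r)⁻¹ * ((g r).re ^ 2 + (g r).im ^ 2) +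
          (1 - r ^ 2) * ((P r).re ^ 2 + (P r).im ^ 2) = 0 :=
        (mul_eq_zero.1 h).resolve_left (by positivity)
      have hM : 0 ≤ (1 - r ^ 2) * ((P r).re ^ 2 + (P r).im ^ 2) := by positivity
      have hN : (g r).re ^ 2 + (g r).im ^ 2 = 0 := by
        by_contra hne
        have hpos : 0 < (g r).re ^ 2 + (g r).im ^ 2 := lt_of_le_of_ne (by positivity) (Ne.symm hne)
        have : 0 < (partnerWeight r)⁻¹ * ((g r).re ^ 2 + (g r).im ^ 2) := by positivity
        linarith
      apply Complex.ext <;> simp only [Complex.zero_re, Complex.zero_im] <;> nlinarith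
    · intro r hr
      have h1 : 1 - r ^ 2 ≠ 0 := by nlinarith [hr.1, hr.2]
      have h2 : 1 + r ≠ 0 := by linarith [hr.1]
      have hq := (partnerWeight_pos hr).ne'
      refine ((hasDerivAt_one_sub_sq_rpow (1 - m.re) hr).mul
        (((hg r hr).complex_re.mul (hP r hr).complex_re).add
          ((hg r hr).complex_im.mul (hP r hr).complex_im))).congr_deriv ?_
      simp only [Complex.add_re, Complex.add_im, Complex.sub_re, Complex.sub_im,
        Complex.mul_re, Complex.mul_im, Complex.ofReal_re, Complex.ofReal_im, hb,
        Pi.add_apply, Pi.mul_apply]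
      generalize (1 - r ^ 2) ^ (1 - m.re) = w
      generalize partnerWeight r = q at hq ⊢
      field_simp
      ring
    · intro r hr
      have hq := partnerWeight_pos hr
      have h1 : 0 < 1 - r ^ 2 := by nlinarith [hr.1, hr.2]
      positivity
    · have : (m.re - 1) * ((P 1).re ^ 2 + (P 1).im ^ 2) ≤ 0 :=
        mul_nonpos_of_nonpos_of_nonneg (by linarith) (by positivity)
      simp only [hg0, hg1, Complex.mul_re, Complex.mul_im, Complex.sub_re, Complex.sub_im,
        Complex.one_re, Complex.one_im, Complex.zero_re, Complex.zero_im, hb]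
      generalize ((1 : ℝ) - 1 ^ 2) ^ (1 - m.re) = w at hw1 ⊢
      nlinarith [mul_nonneg hw1 (neg_nonneg.2 this)]
  · have hK : ∀ r ∈ Ioo (0 : ℝ) 1, 0 < (1 - r ^ 2) * (r * (3 + 6 * r ^ 2 - r ^ 4) / (3 - r ^ 2) ^ 2)
        + 2 * (r - m.re) * partnerWeight r := by
      intro r hr
      obtain ⟨h0, h1⟩ := hr
      have hd : 0 < 3 - r ^ 2 := by nlinarith
      have hq := partnerWeight_pos ⟨h0, h1⟩
      have hlog : 2 * partnerWeight r < r * (3 + 6 * r ^ 2 - r ^ 4) / (3 - r ^ 2) ^ 2 := by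
        unfold partnerWeight
        rw [← sub_pos]
        have hsub : r * (3 + 6 * r ^ 2 - r ^ 4) / (3 - r ^ 2) ^ 2
            - 2 * (r ^ 2 * (1 + r ^ 2) / (2 * (3 - r ^ 2)))
            = r * ((3 - r ^ 4) * (1 - r) + 2 * r ^ 2 * (3 - r)) / (3 - r ^ 2) ^ 2 := by
          field_simp
          ring
        have h4 : r ^ 4 < 1 := pow_lt_one₀ h0.le h1 (by norm_num)
        have hbr : 0 < (3 - r ^ 4) * (1 - r) + 2 * r ^ 2 * (3 - r) :=
          add_pos (mul_pos (by linarith) (by linarith)) (mul_pos (by positivity) (by linarith))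
        rw [hsub]
        positivity
      have hfac : 0 < 1 - r ^ 2 := by nlinarith
      have e1 := mul_lt_mul_of_pos_left hlog hfac
      nlinarith [mul_nonneg (sub_nonneg.2 hm) hq.le, mul_pos (mul_pos h0 (sub_pos.2 h1)) hq]
    have key := deriv_eq_zero_of_nonneg_of_le
      (F := fun x => (1 - x ^ 2) ^ (1 - m.re) *
        (m.im ^ 2 * (partnerWeight x * ((P x).re ^ 2 + (P x).im ^ 2))
          - m.im * ((g x).im * (P x).re - (g x).re * (P x).im)))
      (F' := fun r => (1 - r ^ 2) ^ (1 - m.re) / (1 - r ^ 2) * m.im ^ 2 *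
        ((1 - r ^ 2) * (r * (3 + 6 * r ^ 2 - r ^ 4) / (3 - r ^ 2) ^ 2)
          + 2 * (r - m.re) * partnerWeight r) * ((P r).re ^ 2 + (P r).im ^ 2))
      (by fun_prop) ?_ ?_ ?_
    · have hP0 : ∀ r ∈ Ioo (0 : ℝ) 1, P r = 0 := by
        intro r hr
        have hq := partnerWeight_pos hr
        have h1 : 0 < 1 - r ^ 2 := by nlinarith [hr.1, hr.2]
        have hw : 0 < (1 - r ^ 2) ^ (1 - m.re) := Real.rpow_pos_of_pos h1 _
        have hK' := hK r hr
        have hM : (P r).re ^ 2 + (P r).im ^ 2 = 0 :=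
          (mul_eq_zero.1 (key r hr)).resolve_left (by positivity)
        apply Complex.ext <;> simp only [Complex.zero_re, Complex.zero_im] <;> nlinarith
      intro r hr
      have hq := (partnerWeight_pos hr).ne'
      have h1 : 1 - r ^ 2 ≠ 0 := by nlinarith [hr.1, hr.2]
      have hconst : P =ᶠ[nhds r] fun _ => 0 := by
        filter_upwards [Ioo_mem_nhds hr.1 hr.2] with x hx using hP0 x hx
      have h := (hP r hr).unique ((hasDerivAt_const r (0 : ℂ)).congr_of_eventuallyEq hconst)
      rw [hP0 r hr, mul_zero, mul_zero, mul_zero, add_zero, sub_zero] at h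
      simpa only [mul_eq_zero, Complex.ofReal_eq_zero, inv_eq_zero, h1, hq, false_or] using h
    · intro r hr
      have h1 : 1 - r ^ 2 ≠ 0 := by nlinarith [hr.1, hr.2]
      have h2 : 1 + r ≠ 0 := by linarith [hr.1]
      have h3 : 3 - r ^ 2 ≠ 0 := by nlinarith [hr.1, hr.2]
      have hq := (partnerWeight_pos hr).ne'
      refine ((hasDerivAt_one_sub_sq_rpow (1 - m.re) hr).mul
        ((((hasDerivAt_partnerWeight hr).mul
          (((hP r hr).complex_re.pow 2).add ((hP r hr).complex_im.pow 2))).const_mul (m.im ^ 2)).sub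
        ((((hg r hr).complex_im.mul (hP r hr).complex_re).sub
          ((hg r hr).complex_re.mul (hP r hr).complex_im)).const_mul m.im))).congr_deriv ?_
      simp only [Complex.add_re, Complex.add_im, Complex.sub_re, Complex.sub_im,
        Complex.mul_re, Complex.mul_im, Complex.ofReal_re, Complex.ofReal_im,
        Pi.add_apply, Pi.mul_apply, Pi.sub_apply, Pi.pow_apply]
      generalize (1 - r ^ 2) ^ (1 - m.re) = w
      generalize partnerWeight r = q at hq ⊢
      field_simp
      ring
    · intro r hr
      have hK' := hK r hr
      have h1 : 0 < 1 - r ^ 2 := by nlinarith [hr.1, hr.2]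
      positivity
    · have hq0 : partnerWeight 0 = 0 := by simp [partnerWeight]
      have hq1 : partnerWeight 1 = 1 / 2 := by norm_num [partnerWeight]
      have : 0 ≤ m.im ^ 2 * ((P 1).re ^ 2 + (P 1).im ^ 2) := by positivity
      simp only [hg0, hg1, Complex.mul_re, Complex.mul_im, Complex.sub_re, Complex.sub_im,
        Complex.one_re, Complex.one_im, Complex.zero_re, Complex.zero_im, hq0, hq1]
      generalize ((1 : ℝ) - 1 ^ 2) ^ (1 - m.re) = w at hw1 ⊢
      nlinarith [mul_nonneg hw1 this]

/-- The supersymmetric transform of a solution `f` with derivative `f₁`, where `m = 1 - l`. -/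
noncomputable def partnerFst (m : ℂ) (f f₁ : ℝ → ℂ) (r : ℝ) : ℂ :=
  (1 - (r : ℂ) ^ 2) * r * f₁ r
    + (m * (r : ℂ) ^ 2 - (1 - (r : ℂ) ^ 2) ^ 2 / (1 + (r : ℂ) ^ 2)) * f r

/-- The (covariant) derivative of `partnerFst` in terms of `f` and its first two derivatives. -/
noncomputable def partnerSnd (m : ℂ) (f f₁ f₂ : ℝ → ℂ) (r : ℝ) : ℂ :=
  (1 - 3 * (r : ℂ) ^ 2) * f₁ r + (1 - (r : ℂ) ^ 2) * r * f₂ r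
    + (2 * m * r + 2 * r * (1 - (r : ℂ) ^ 2) * (3 + (r : ℂ) ^ 2) / (1 + (r : ℂ) ^ 2) ^ 2) * f r
    + (m * (r : ℂ) ^ 2 - (1 - (r : ℂ) ^ 2) ^ 2 / (1 + (r : ℂ) ^ 2)) * f₁ r
    - (1 + (r : ℂ))⁻¹ * (m * partnerFst m f f₁ r)

/-- `partnerSnd` for a solution of the spectral equation, with the second derivative eliminated. -/
noncomputable def partnerSndReduced (m : ℂ) (f f₁ : ℝ → ℂ) (r : ℝ) : ℂ :=
  (-2 * (1 - (r : ℂ) ^ 2) / (1 + (r : ℂ) ^ 2) - m * r) * f₁ r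
    + (2 * (1 - (r : ℂ) ^ 2) ^ 2 / (r * (1 + (r : ℂ) ^ 2) ^ 2)
      + m * (1 - 2 * r - (r : ℂ) ^ 2) / (1 + (r : ℂ) ^ 2) + m ^ 2 * r / (1 + r)) * f r

/-- The left-hand side of the spectral equation multiplied by `ρ²`, for `l = 1 - m`. -/
noncomputable def spectralResidual (m : ℂ) (f f₁ f₂ : ℝ → ℂ) (r : ℝ) : ℂ :=
  -(1 - (r : ℂ) ^ 2) * (r : ℂ) ^ 2 * f₂ r - 2 * r * f₁ r + 2 * (2 - m) * (r : ℂ) ^ 3 * f₁ r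
    + 2 * (1 - 6 * (r : ℂ) ^ 2 + (r : ℂ) ^ 4) / (1 + (r : ℂ) ^ 2) ^ 2 * f r
    + (1 - m) * (2 - m) * (r : ℂ) ^ 2 * f r

theorem one_add_ofReal_sq_ne_zero (r : ℝ) : 1 + (r : ℂ) ^ 2 ≠ 0 := by
  have h : 1 + r ^ 2 ≠ 0 := by positivity
  exact_mod_cast h

theorem one_add_ofReal_ne_zero {r : ℝ} (hr : 0 ≤ r) : 1 + (r : ℂ) ≠ 0 := by
  have h : 1 + r ≠ 0 := by positivity
  exact_mod_cast h

theorem one_sub_ofReal_sq_ne_zero {r : ℝ} (hr : r ∈ Ioo (0 : ℝ) 1) : 1 - (r : ℂ) ^ 2 ≠ 0 := by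
  have h : 1 - r ^ 2 ≠ 0 := by nlinarith [hr.1, hr.2]
  exact_mod_cast h

section

variable {m : ℂ} {f f₁ f₂ : ℝ → ℂ} {r : ℝ}

theorem hasDerivAt_partnerFst (hf : HasDerivAt f (f₁ r) r) (hf₁ : HasDerivAt f₁ (f₂ r) r) :
    HasDerivAt (partnerFst m f f₁)
      (partnerSnd m f f₁ f₂ r + (1 + (r : ℂ))⁻¹ * (m * partnerFst m f f₁ r)) r := by
  have h1 := one_add_ofReal_sq_ne_zero r
  have hx : HasDerivAt (fun x : ℝ => (x : ℂ)) 1 r := (hasDerivAt_id r).ofReal_comp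
  have ht := hx.pow 2
  refine ((((ht.const_sub 1).mul hx).mul hf₁).add
    (((ht.const_mul m).sub (((ht.const_sub 1).pow 2).div (ht.const_add 1) h1)).mul
      hf)).congr_deriv ?_
  simp only [partnerSnd, Pi.mul_apply, Pi.pow_apply, Pi.div_apply, Pi.sub_apply]
  field_simp
  ring

theorem partnerSnd_eq_reduced (hr : r ∈ Ioo (0 : ℝ) 1) (h : spectralResidual m f f₁ f₂ r = 0) :
    partnerSnd m f f₁ f₂ r = partnerSndReduced m f f₁ r := by
  have h0 : (r : ℂ) ≠ 0 := Complex.ofReal_ne_zero.2 hr.1.ne'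
  have h1 := one_add_ofReal_sq_ne_zero r
  have h2 := one_add_ofReal_ne_zero hr.1.le
  have key : partnerSnd m f f₁ f₂ r = partnerSndReduced m f f₁ r
      - spectralResidual m f f₁ f₂ r / r := by
    simp only [partnerSnd, partnerFst, partnerSndReduced, spectralResidual]
    field_simp
    ring
  rw [key, h, zero_div, sub_zero]

theorem hasDerivAt_partnerSndReduced (hr : r ∈ Ioo (0 : ℝ) 1) (hf : HasDerivAt f (f₁ r) r)
    (hf₁ : HasDerivAt f₁ (f₂ r) r) (h : spectralResidual m f f₁ f₂ r = 0) :
    HasDerivAt (partnerSndReduced m f f₁) (((1 - r ^ 2)⁻¹ : ℝ) *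
      (((partnerWeight r)⁻¹ : ℝ) * partnerFst m f f₁ r + (2 * r : ℝ) * partnerSndReduced m f f₁ r
        - (1 + r : ℝ) * (m * partnerSndReduced m f f₁ r))) r := by
  have h0 : (r : ℂ) ≠ 0 := Complex.ofReal_ne_zero.2 hr.1.ne'
  have h1 := one_add_ofReal_sq_ne_zero r
  have h2 := one_add_ofReal_ne_zero hr.1.le
  have h3 := one_sub_ofReal_sq_ne_zero hr
  have hx : HasDerivAt (fun x : ℝ => (x : ℂ)) 1 r := (hasDerivAt_id r).ofReal_comp
  have ht := hx.pow 2
  have hf₂ : f₂ r = (-2 * r * f₁ r + 2 * (2 - m) * (r : ℂ) ^ 3 * f₁ r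
      + 2 * (1 - 6 * (r : ℂ) ^ 2 + (r : ℂ) ^ 4) / (1 + (r : ℂ) ^ 2) ^ 2 * f r
      + (1 - m) * (2 - m) * (r : ℂ) ^ 2 * f r) / ((1 - (r : ℂ) ^ 2) * (r : ℂ) ^ 2) := by
    rw [eq_div_iff (mul_ne_zero h3 (pow_ne_zero 2 h0))]
    unfold spectralResidual at h
    linear_combination -h
  refine ((((((ht.const_sub 1).const_mul (-2)).div (ht.const_add 1) h1).sub
      (hx.const_mul m)).mul hf₁).add
    (((((((ht.const_sub 1).pow 2).const_mul 2).div (hx.mul ((ht.const_add 1).pow 2))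
        (mul_ne_zero h0 (pow_ne_zero 2 h1))).add
      (((((hx.const_mul 2).const_sub 1).sub ht).const_mul m).div (ht.const_add 1) h1)).add
      ((hx.const_mul (m ^ 2)).div (hx.const_add 1) h2)).mul hf)).congr_deriv ?_
  rw [hf₂]
  simp only [partnerSndReduced, partnerFst, partnerWeight, Pi.mul_apply, Pi.pow_apply,
    Pi.div_apply, Pi.sub_apply, Pi.add_apply]
  push_cast
  field_simp
  ring

theorem eq_zero_of_partner_eq_zero (hm : m ≠ 0) (hr : r ∈ Ioo (0 : ℝ) 1)
    (hg : partnerFst m f f₁ r = 0) (hP : partnerSndReduced m f f₁ r = 0) : f r = 0 := by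
  have h0 : (r : ℂ) ≠ 0 := Complex.ofReal_ne_zero.2 hr.1.ne'
  have h1 := one_add_ofReal_sq_ne_zero r
  have h2 := one_add_ofReal_ne_zero hr.1.le
  have key : m ^ 2 * (r : ℂ) ^ 2 * f r
      = (1 - (r : ℂ) ^ 2) * r * partnerSndReduced m f f₁ r
        - (-2 * (1 - (r : ℂ) ^ 2) / (1 + (r : ℂ) ^ 2) - m * r) * partnerFst m f f₁ r := by
    simp only [partnerSndReduced, partnerFst]
    field_simp
    ring
  rw [hg, hP, mul_zero, mul_zero, sub_zero] at key
  simpa [hm, h0] using key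

end

theorem eqOn_zero_Icc_of_Ioo {F : ℝ → ℂ} (hc : ContinuousOn F (Icc 0 1))
    (h : ∀ r ∈ Ioo (0 : ℝ) 1, F r = 0) : ∀ r ∈ Icc (0 : ℝ) 1, F r = 0 := by
  have h' : EqOn F (fun _ => 0) (Ioo 0 1) := h
  exact h'.of_subset_closure hc continuousOn_const Ioo_subset_Icc_self
    (closure_Ioo (zero_ne_one (α := ℝ))).ge

/-- Mode stability of the self-similar wave maps blowup. -/
theorem mode_stability (l : ℂ) (hl : 0 ≤ l.re) (hl1 : l ≠ 1) (f : ℝ → ℂ)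
    (hf : ContDiffOn ℝ (⊤ : ℕ∞) f (Icc 0 1))
    (heq : ∀ ρ ∈ Ioo (0 : ℝ) 1, SpectralEq l f ρ) :
    ∀ ρ ∈ Icc (0 : ℝ) 1, f ρ = 0 := by
  have hu : UniqueDiffOn ℝ (Icc (0 : ℝ) 1) := uniqueDiffOn_Icc one_pos
  set f₁ := derivWithin f (Icc 0 1)
  set f₂ := derivWithin f₁ (Icc 0 1)
  have hf₁ : ContDiffOn ℝ 1 f₁ (Icc 0 1) := hf.derivWithin hu (WithTop.coe_le_coe.2 (le_top (a := (1 + 1 : ℕ∞))))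
  have hfc : ContinuousOn f (Icc 0 1) := hf.continuousOn
  have hf₁c : ContinuousOn f₁ (Icc 0 1) := hf₁.continuousOn
  have hf₂c : ContinuousOn f₂ (Icc 0 1) := hf₁.continuousOn_derivWithin hu le_rfl
  have hfd : ∀ r ∈ Ioo (0 : ℝ) 1, HasDerivAt f (f₁ r) r := fun r hr =>
    ((hf.differentiableOn (by simp)) r (Ioo_subset_Icc_self hr)).hasDerivWithinAt.hasDerivAt
      (Icc_mem_nhds hr.1 hr.2)
  have hf₁d : ∀ r ∈ Ioo (0 : ℝ) 1, HasDerivAt f₁ (f₂ r) r := fun r hr =>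
    ((hf₁.differentiableOn (by simp)) r (Ioo_subset_Icc_self hr)).hasDerivWithinAt.hasDerivAt
      (Icc_mem_nhds hr.1 hr.2)
  have hxc : ContinuousOn (fun r : ℝ => (r : ℂ)) (Icc 0 1) :=
    Complex.continuous_ofReal.continuousOn
  have hinv : ContinuousOn (fun r : ℝ => (1 + (r : ℂ) ^ 2)⁻¹) (Icc 0 1) :=
    ContinuousOn.inv₀ (by fun_prop) fun r _ => one_add_ofReal_sq_ne_zero r
  have hinv' : ContinuousOn (fun r : ℝ => (1 + (r : ℂ))⁻¹) (Icc 0 1) :=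
    ContinuousOn.inv₀ (by fun_prop) fun r hr => one_add_ofReal_ne_zero hr.1
  obtain ⟨m, rfl⟩ : ∃ m, l = 1 - m := ⟨1 - l, by ring⟩
  have hm0 : m ≠ 0 := by simpa using hl1
  have hm1 : m.re ≤ 1 := by simpa using hl
  have hres : ∀ r ∈ Icc (0 : ℝ) 1, spectralResidual m f f₁ f₂ r = 0 := by
    refine eqOn_zero_Icc_of_Ioo ?_ fun r hr => ?_
    · unfold spectralResidual
      simp only [div_eq_mul_inv, ← inv_pow]
      fun_prop
    · have h0 : (r : ℂ) ≠ 0 := Complex.ofReal_ne_zero.2 hr.1.ne'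
      have h1 := one_add_ofReal_sq_ne_zero r
      have hd : deriv f =ᶠ[nhds r] f₁ := by
        filter_upwards [Ioo_mem_nhds hr.1 hr.2] with x hx using (hfd x hx).deriv
      have h := heq r hr
      rw [SpectralEq, hd.deriv_eq, (hfd r hr).deriv, (hf₁d r hr).deriv] at h
      have key : spectralResidual m f f₁ f₂ r = (r : ℂ) ^ 2 * 0 := by
        rw [← h, spectralResidual]
        field_simp
        ring
      rw [key, mul_zero]
  have hf0 : f 0 = 0 := by
    simpa [spectralResidual] using hres 0 (left_mem_Icc.2 zero_le_one)
  have hf1 : (2 - 2 * m) * f₁ 1 + (m ^ 2 - 3 * m) * f 1 = 0 := by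
    have h := hres 1 (right_mem_Icc.2 zero_le_one)
    simp only [spectralResidual, Complex.ofReal_one] at h
    linear_combination h
  have hsnd : ∀ r ∈ Ioo (0 : ℝ) 1, partnerSnd m f f₁ f₂ r = partnerSndReduced m f f₁ r :=
    fun r hr => partnerSnd_eq_reduced hr (hres r (Ioo_subset_Icc_self hr))
  have hgc : ContinuousOn (partnerFst m f f₁) (Icc 0 1) := by
    unfold partnerFst
    simp only [div_eq_mul_inv]
    fun_prop
  have hg : ∀ r ∈ Ioo (0 : ℝ) 1, partnerFst m f f₁ r = 0 := by
    refine partner_system_eq_zero hm1 (P := partnerSnd m f f₁ f₂) hgc ?_ ?_ ?_ ?_ ?_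
    · unfold partnerSnd
      simp only [div_eq_mul_inv, ← inv_pow]
      fun_prop
    · intro r hr
      exact_mod_cast hasDerivAt_partnerFst (hfd r hr) (hf₁d r hr)
    · intro r hr
      rw [hsnd r hr]
      refine (hasDerivAt_partnerSndReduced hr (hfd r hr) (hf₁d r hr)
        (hres r (Ioo_subset_Icc_self hr))).congr_of_eventuallyEq ?_
      filter_upwards [Ioo_mem_nhds hr.1 hr.2] with x hx using hsnd x hx
    · simp [partnerFst, hf0]
    · simp only [partnerFst, partnerSnd, Complex.ofReal_one]
      linear_combination ((m - 2) / 2) * hf1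
  refine eqOn_zero_Icc_of_Ioo hfc fun r hr => eq_zero_of_partner_eq_zero hm0 hr (hg r hr) ?_
  have hconst : partnerFst m f f₁ =ᶠ[nhds r] fun _ => 0 := by
    filter_upwards [Ioo_mem_nhds hr.1 hr.2] with x hx using hg x hx
  have h := (hasDerivAt_partnerFst (m := m) (hfd r hr) (hf₁d r hr)).unique
    ((hasDerivAt_const r (0 : ℂ)).congr_of_eventuallyEq hconst)
  rwa [hg r hr, mul_zero, mul_zero, add_zero, hsnd r hr] at h
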